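/- Let S be a Suslin tree, θ a sufficiently large regular cardinal, M a countable elementary substructure of H(θ) with S ∈ M, and δ = M ∩ ω₁. If X ∈ M is a subset of S, x ∈ S has height δ, and there is some z ∈ X with x ≤_S z, then there exists y <_S x with y ∈ X. -/

import Mathlib

noncomputable section

open Cardinal FirstOrder

/-- The first uncountable ordinal. -/
def omegaOne : Ordinal := (Cardinal.aleph 1).ord

/-- `H(θ)`: the collection of sets hereditarily of cardinality less than `θ`. -/
def HSet (θ : Cardinal.{1}) : Type 1 :=
  {x : ZFSet // ZFSet.Hereditarily (fun y => #y.toSet < θ) x}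

/-- The `∈`-structure on `H(θ)`, in the language with a single binary relation. -/
instance HSet.struc (θ : Cardinal.{1}) : Language.graph.Structure (HSet θ) where
  funMap := fun f _ => f.elim
  RelMap := fun r v =>
    match r with
    | .adj => (v 0).1 ∈ (v 1).1

/-- The order of a tree coded as a `ZFSet` `r` of Kuratowski pairs. -/
def zle (r a b : ZFSet) : Prop := ZFSet.pair a b ∈ r

/-- A `ZFSet` is a (von Neumann) ordinal iff it is a transitive set of transitive sets. -/
def ZFOrdinal (o : ZFSet) : Prop := o.IsTransitive ∧ ∀ a ∈ o, ZFSet.IsTransitive a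


/-- First-order definability (without parameters) of a predicate on assignments. -/
def FODef {θ : Cardinal.{1}} {α : Type} (P : (α → HSet θ) → Prop) : Prop :=
  ∃ φ : Language.graph.Formula α, ∀ v, φ.Realize v ↔ P v

namespace FODef

variable {θ : Cardinal.{1}} {α : Type}

theorem mem (i j : α) : FODef (θ := θ) (fun w => (w i).1 ∈ (w j).1) :=
  ⟨Language.adj.formula₂ (.var i) (.var j), fun v => by
    rw [Language.Formula.realize_rel₂]
    rfl⟩

theorem eq (i j : α) : FODef (θ := θ) (fun w => w i = w j) :=
  ⟨Language.Term.equal (.var i) (.var j), fun v => by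
    rw [Language.Formula.realize_equal]
    rfl⟩

theorem and {P Q : (α → HSet θ) → Prop} (hP : FODef P) (hQ : FODef Q) :
    FODef (fun w => P w ∧ Q w) := by
  obtain ⟨φ, hφ⟩ := hP
  obtain ⟨ψ, hψ⟩ := hQ
  exact ⟨φ ⊓ ψ, fun v => by rw [Language.Formula.realize_inf, hφ, hψ]⟩

theorem imp {P Q : (α → HSet θ) → Prop} (hP : FODef P) (hQ : FODef Q) :
    FODef (fun w => P w → Q w) := by
  obtain ⟨φ, hφ⟩ := hP
  obtain ⟨ψ, hψ⟩ := hQ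
  exact ⟨φ.imp ψ, fun v => by rw [Language.Formula.realize_imp, hφ, hψ]⟩

theorem not {P : (α → HSet θ) → Prop} (hP : FODef P) :
    FODef (fun w => ¬ P w) := by
  obtain ⟨φ, hφ⟩ := hP
  exact ⟨φ.not, fun v => by rw [Language.Formula.realize_not, hφ]⟩

theorem congr {P Q : (α → HSet θ) → Prop} (hP : FODef P) (h : ∀ w, P w ↔ Q w) :
    FODef Q := by
  obtain ⟨φ, hφ⟩ := hP
  exact ⟨φ, fun v => by rw [hφ, h]⟩

theorem or {P Q : (α → HSet θ) → Prop} (hP : FODef P) (hQ : FODef Q) :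
    FODef (fun w => P w ∨ Q w) :=
  (imp (not hP) hQ).congr fun w => by tauto

theorem iff {P Q : (α → HSet θ) → Prop} (hP : FODef P) (hQ : FODef Q) :
    FODef (fun w => P w ↔ Q w) :=
  (and (imp hP hQ) (imp hQ hP)).congr fun w => by tauto

theorem ex {P : (α → HSet θ) → HSet θ → Prop}
    (hP : FODef (fun w : α ⊕ Unit → HSet θ => P (fun i => w (Sum.inl i)) (w (Sum.inr ())))) :
    FODef (fun w => ∃ a, P w a) := by
  obtain ⟨φ, hφ⟩ := hP
  refine ⟨φ.iExs Unit, fun v => ?_⟩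
  rw [Language.Formula.realize_iExs]
  simp only [hφ, Sum.elim_inl, Sum.elim_inr]
  exact ⟨fun ⟨i, h⟩ => ⟨_, h⟩, fun ⟨a, h⟩ => ⟨fun _ => a, h⟩⟩

theorem all {P : (α → HSet θ) → HSet θ → Prop}
    (hP : FODef (fun w : α ⊕ Unit → HSet θ => P (fun i => w (Sum.inl i)) (w (Sum.inr ())))) :
    FODef (fun w => ∀ a, P w a) :=
  (not (ex (P := fun w a => ¬ P w a) (not hP))).congr fun w => by simp

/-- Witnesses for definable existential statements with parameters in `M` lie in `M`. -/
theorem witness (M : Language.graph.ElementarySubstructure (HSet θ))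
    {Q : (α → HSet θ) → HSet θ → Prop}
    (hQ : FODef (fun w : α ⊕ Unit → HSet θ => Q (fun i => w (Sum.inl i)) (w (Sum.inr ()))))
    (v : α → HSet θ) (hv : ∀ i, v i ∈ M) (h : ∃ a, Q v a) : ∃ a ∈ M, Q v a := by
  obtain ⟨φ, hφ⟩ := hQ
  have h1 : (φ.iExs Unit).Realize (M.subtype ∘ fun i => (⟨v i, hv i⟩ : M)) := by
    rw [Language.Formula.realize_iExs]
    obtain ⟨a, ha⟩ := h
    exact ⟨fun _ => a, (hφ _).2 ha⟩
  rw [M.subtype.map_formula, Language.Formula.realize_iExs] at h1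
  obtain ⟨i, hi⟩ := h1
  rw [← M.subtype.map_formula, hφ] at hi
  exact ⟨(i ()).1, (i ()).2, hi⟩

end FODef

/-- Elements of members of `H(θ)` are in `H(θ)`. -/
def HSet.ofMem {θ : Cardinal.{1}} (X : HSet θ) {a : ZFSet} (h : a ∈ X.1) : HSet θ :=
  ⟨a, X.2.mem h⟩

theorem FODef.pair {θ : Cardinal.{1}} {α : Type} (p a b : α) :
    FODef (θ := θ) (fun w => (w p).1 = ZFSet.pair (w a).1 (w b).1) := by
  have key : FODef (θ := θ) (fun w : α → HSet θ => ∃ s t : HSet θ,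
      (∀ c : HSet θ, c.1 ∈ s.1 ↔ c = w a) ∧ (∀ c : HSet θ, c.1 ∈ t.1 ↔ (c = w a ∨ c = w b)) ∧
      (∀ c : HSet θ, c.1 ∈ (w p).1 ↔ (c = s ∨ c = t))) := by
    refine ex (ex (and (all ?_) (and (all ?_) (all ?_))))
    · exact iff (mem _ _) (eq _ _)
    · exact iff (mem _ _) (or (eq _ _) (eq _ _))
    · exact iff (mem _ _) (or (eq _ _) (eq _ _))
  refine key.congr fun w => ?_
  constructor
  · rintro ⟨s, t, hs, ht, hp⟩
    have es : s.1 = {(w a).1} := by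
      ext c
      rw [ZFSet.mem_singleton]
      constructor
      · intro hc
        exact congrArg Subtype.val ((hs (s.ofMem hc)).1 hc)
      · rintro rfl
        exact (hs (w a)).2 rfl
    have et : t.1 = {(w a).1, (w b).1} := by
      ext c
      rw [ZFSet.mem_pair]
      constructor
      · intro hc
        exact ((ht (t.ofMem hc)).1 hc).imp (congrArg Subtype.val) (congrArg Subtype.val)
      · rintro (rfl | rfl)
        · exact (ht (w a)).2 (Or.inl rfl)
        · exact (ht (w b)).2 (Or.inr rfl)
    ext c
    rw [ZFSet.pair, ZFSet.mem_pair, ← es, ← et]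
    constructor
    · intro hc
      exact ((hp ((w p).ofMem hc)).1 hc).imp (congrArg Subtype.val) (congrArg Subtype.val)
    · rintro (rfl | rfl)
      · exact (hp s).2 (Or.inl rfl)
      · exact (hp t).2 (Or.inr rfl)
  · intro h
    have h1 : ({(w a).1} : ZFSet) ∈ (w p).1 := by rw [h, ZFSet.pair, ZFSet.mem_pair]; exact .inl rfl
    have h2 : ({(w a).1, (w b).1} : ZFSet) ∈ (w p).1 := by
      rw [h, ZFSet.pair, ZFSet.mem_pair]; exact .inr rfl
    refine ⟨(w p).ofMem h1, (w p).ofMem h2, fun c => ?_, fun c => ?_, fun c => ?_⟩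
    · exact ZFSet.mem_singleton.trans Subtype.ext_iff.symm
    · exact ZFSet.mem_pair.trans (or_congr Subtype.ext_iff.symm Subtype.ext_iff.symm)
    · rw [h]
      exact ZFSet.mem_pair.trans (or_congr (Subtype.ext_iff (a2 := (w p).ofMem h1)).symm
        (Subtype.ext_iff (a2 := (w p).ofMem h2)).symm)

theorem FODef.zle {θ : Cardinal.{1}} {α : Type} (r a b : α) :
    FODef (θ := θ) (fun w => zle (w r).1 (w a).1 (w b).1) := by
  have key : FODef (θ := θ) (fun w : α → HSet θ => ∃ p : HSet θ,
      p.1 ∈ (w r).1 ∧ p.1 = ZFSet.pair (w a).1 (w b).1) :=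
    ex (and (mem _ _) (pair _ _ _))
  refine key.congr fun w => ?_
  constructor
  · rintro ⟨p, hp, e⟩
    rw [e] at hp
    exact hp
  · intro h
    exact ⟨(w r).ofMem h, h, rfl⟩

/-- Countable sets of members of `H(θ)` are members of `H(θ)`. -/
theorem HSet.exists_of_countable {θ : Cardinal.{1}} (hθ : ℵ₀ < θ) (T : Set ZFSet)
    (hT : T.Countable) (hH : ∀ a ∈ T, ZFSet.Hereditarily (fun y => #y.toSet < θ) a) :
    ∃ z : HSet θ, ∀ w, w ∈ z.1 ↔ w ∈ T := by
  obtain ⟨z, hz⟩ : ∃ z : ZFSet, ∀ w, w ∈ z ↔ w ∈ T := by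
    rcases T.eq_empty_or_nonempty with rfl | hne
    · exact ⟨∅, fun w => by simp⟩
    · obtain ⟨f, rfl⟩ := hT.exists_eq_range hne
      exact ⟨ZFSet.range f, fun w => by rw [ZFSet.mem_range]; rfl⟩
  refine ⟨⟨z, ZFSet.hereditarily_iff.2 ⟨?_, fun y hy => hH y ((hz y).1 hy)⟩⟩, hz⟩
  have e : z.toSet = T := Set.ext hz
  change #z.toSet < θ
  rw [e]
  exact (Cardinal.mk_le_aleph0_iff.2 hT).trans_lt hθ

theorem HSet.hered_of_countable {θ : Cardinal.{1}} (hθ : ℵ₀ < θ) (x : ZFSet)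
    (hT : {y | y ∈ x}.Countable)
    (hH : ∀ a ∈ x, ZFSet.Hereditarily (fun y => #y.toSet < θ) a) :
    ZFSet.Hereditarily (fun y => #y.toSet < θ) x := by
  obtain ⟨z, hz⟩ := HSet.exists_of_countable hθ {y | y ∈ x} hT hH
  have : z.1 = x := ZFSet.ext hz
  exact this ▸ z.2

theorem HSet.hered_pair {θ : Cardinal.{1}} (hθ : ℵ₀ < θ) {a b : ZFSet}
    (ha : ZFSet.Hereditarily (fun y => #y.toSet < θ) a)
    (hb : ZFSet.Hereditarily (fun y => #y.toSet < θ) b) :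
    ZFSet.Hereditarily (fun y => #y.toSet < θ) (ZFSet.pair a b) := by
  have two : ∀ c d : ZFSet, ZFSet.Hereditarily (fun y => #y.toSet < θ) c →
      ZFSet.Hereditarily (fun y => #y.toSet < θ) d →
      ZFSet.Hereditarily (fun y => #y.toSet < θ) {c, d} := by
    intro c d hc hd
    apply HSet.hered_of_countable hθ
    · have : {y | y ∈ ({c, d} : ZFSet)} = {c, d} := by ext y; simp
      rw [this]
      exact (Set.toFinite _).countable
    · intro y hy
      rcases ZFSet.mem_pair.1 hy with rfl | rfl <;> assumption
  have h1 := two a a ha ha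
  rw [ZFSet.pair_eq_singleton] at h1
  exact two _ _ h1 (two a b ha hb)

theorem HSet.hered_toZFSet {θ : Cardinal.{1}} (hθ : ℵ₀ < θ) (o : Ordinal.{0})
    (ho : o < omegaOne) : ZFSet.Hereditarily (fun y => #y.toSet < θ) o.toZFSet := by
  induction o using WellFoundedLT.induction with
  | ind o ih =>
    apply HSet.hered_of_countable hθ
    · have : {y | y ∈ o.toZFSet} = Ordinal.toZFSet '' Set.Iio o := by
        ext y; simp [Ordinal.mem_toZFSet_iff]
      rw [this]
      apply Set.Countable.image
      rw [← Cardinal.le_aleph0_iff_set_countable, Cardinal.mk_Iio_ordinal]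
      have h2 : o.card < ℵ₁ := by rwa [omegaOne, Cardinal.lt_ord] at ho
      have h3 : o.card ≤ ℵ₀ := by
        rwa [← Cardinal.succ_aleph0, Order.lt_succ_iff] at h2
      exact Cardinal.lift_le_aleph0.2 h3
    · intro a ha
      obtain ⟨b, hb, rfl⟩ := Ordinal.mem_toZFSet_iff.1 ha
      exact ih b hb (hb.trans ho)

/-- Let `S` be a Suslin tree (coded by a set `S` with order relation `r` and
height function `ht`), `θ` a sufficiently large regular cardinal, `M` a countable elementary
substructure of `H(θ)` with `S ∈ M`, and `δ = M ∩ ω₁`.  If `X ∈ M` is a subset of `S`,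
`x ∈ S` has height `δ`, and there is some `z ∈ X` with `x ≤_S z`, then there exists
`y <_S x` with `y ∈ X`. -/
theorem rigidKurepa_stmt3 (θ : Cardinal.{1}) (hθreg : θ.IsRegular)
    (hθbig : Cardinal.lift.{1,0} (Cardinal.aleph 1) < θ)
    (M : Language.graph.ElementarySubstructure (HSet θ))
    (hMctble : (M : Set (HSet θ)).Countable)
    -- the tree `S`, its order `r`, and the set `X` are members of `M`:
    (S r X : HSet θ) (hSM : S ∈ M) (hrM : r ∈ M) (hXM : X ∈ M)
    -- `r` is a partial order on `S`:
    (hrS : ∀ a b : ZFSet, zle r.1 a b → a ∈ S.1 ∧ b ∈ S.1)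
    (hrefl : ∀ a, a ∈ S.1 → zle r.1 a a)
    (hantisymm : ∀ a b, zle r.1 a b → zle r.1 b a → a = b)
    (htrans : ∀ a b c, zle r.1 a b → zle r.1 b c → zle r.1 a c)
    -- `(S, r)` is a tree of height `ω₁` with height function `ht`:
    (ht : ZFSet → Ordinal)
    (hht1 : ∀ a, a ∈ S.1 → ht a < omegaOne)
    (hht2 : ∀ a b, zle r.1 a b → a ≠ b → ht a < ht b)
    (hlin : ∀ a b c, zle r.1 b a → zle r.1 c a → (zle r.1 b c ∨ zle r.1 c b))
    (hpred : ∀ a, a ∈ S.1 → ∀ β, β < ht a → ∃ b, b ∈ S.1 ∧ zle r.1 b a ∧ ht b = β)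
    (hsurj : ∀ β, β < omegaOne → ∃ a, a ∈ S.1 ∧ ht a = β)
    -- `S` is Suslin: every chain and every antichain is countable:
    (hchain : ∀ C : Set ZFSet, (∀ a ∈ C, a ∈ S.1) →
      (∀ a ∈ C, ∀ b ∈ C, zle r.1 a b ∨ zle r.1 b a) → C.Countable)
    (hanti : ∀ A : Set ZFSet, (∀ a ∈ A, a ∈ S.1) →
      (∀ a ∈ A, ∀ b ∈ A, a ≠ b → ¬ zle r.1 a b ∧ ¬ zle r.1 b a) → A.Countable)
    -- `δ = M ∩ ω₁`: the predecessors of `δ` are exactly the countable (von Neumann)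
    -- ordinals belonging to `M`:
    (δ : Ordinal)
    (hδ : ∀ β, β < δ ↔ (β < omegaOne ∧
      ∃ o : HSet θ, o ∈ M ∧ ZFOrdinal o.1 ∧ o.1.rank = β))
    -- `X ∈ M` is a subset of `S`, `x ∈ S` has height `δ`, and some `z ∈ X` is above `x`:
    (hXS : ∀ a, a ∈ X.1 → a ∈ S.1)
    (x : ZFSet) (hx : x ∈ S.1) (hxht : ht x = δ)
    (z : ZFSet) (hz : z ∈ X.1) (hxz : zle r.1 x z) :
    ∃ y, y ∈ X.1 ∧ zle r.1 y x ∧ y ≠ x := by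

  have hθ : ℵ₀ < θ := by
    refine lt_of_le_of_lt ?_ hθbig
    simp
  -- heights of members of `M`
  have hM_ht : ∀ y : HSet θ, y ∈ M → y.1 ∈ S.1 → ht y.1 < δ := by
    intro y hyM hyS
    let Q : (Fin 2 → HSet θ) → HSet θ → Prop := fun v o => ∃ f : HSet θ,
      zle f.1 (v 0).1 o.1 ∧
      (∀ b : HSet θ, zle (v 1).1 b.1 (v 0).1 → ∃ u : HSet θ, zle f.1 b.1 u.1) ∧
      (∀ b u : HSet θ, zle (v 1).1 b.1 (v 0).1 → zle f.1 b.1 u.1 →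
        ∀ w : HSet θ, w.1 ∈ u.1 ↔
          ∃ c : HSet θ, (zle (v 1).1 c.1 b.1 ∧ ¬ c = b) ∧ zle f.1 c.1 w.1)
    have hQ : FODef (fun w : Fin 2 ⊕ Unit → HSet θ =>
        Q (fun i => w (Sum.inl i)) (w (Sum.inr ()))) := by
      refine .ex (.and (.zle _ _ _) (.and (.all (.imp (.zle _ _ _) (.ex (.zle _ _ _))))
        (.all (.all (.imp (.zle _ _ _) (.imp (.zle _ _ _) (.all (.iff (.mem _ _)
          (.ex (.and (.and (.zle _ _ _) (.not (.eq _ _))) (.zle _ _ _)))))))))))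
    have hex : ∃ o, Q ![y, r] o := by
      refine ⟨⟨(ht y.1).toZFSet, HSet.hered_toZFSet hθ _ (hht1 _ hyS)⟩, ?_⟩
      have hcC : {b | zle r.1 b y.1}.Countable := by
        apply hchain
        · intro a ha
          exact (hrS _ _ ha).1
        · intro a ha b hb
          exact hlin _ _ _ ha hb
      obtain ⟨f, hf⟩ := HSet.exists_of_countable hθ
        ((fun b => ZFSet.pair b (ht b).toZFSet) '' {b | zle r.1 b y.1}) (hcC.image _) (by
          rintro _ ⟨b, hb, rfl⟩
          have hbS := (hrS _ _ hb).1
          exact HSet.hered_pair hθ (S.2.mem hbS) (HSet.hered_toZFSet hθ _ (hht1 _ hbS)))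
      have hf' : ∀ b u, zle f.1 b u ↔ zle r.1 b y.1 ∧ u = (ht b).toZFSet := by
        intro b u
        refine (hf _).trans ?_
        constructor
        · rintro ⟨c, hc, e⟩
          obtain ⟨rfl, rfl⟩ := ZFSet.pair_inj.1 e
          exact ⟨hc, rfl⟩
        · rintro ⟨h, rfl⟩
          exact ⟨b, h, rfl⟩
      refine ⟨f, (hf' _ _).2 ⟨hrefl _ hyS, rfl⟩, ?_, ?_⟩
      · intro b hb
        exact ⟨⟨_, HSet.hered_toZFSet hθ _ (hht1 _ (hrS _ _ hb).1)⟩, (hf' _ _).2 ⟨hb, rfl⟩⟩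
      · intro b u hb hbu w
        change zle r.1 b.1 y.1 at hb
        rw [((hf' _ _).1 hbu).2, Ordinal.mem_toZFSet_iff]
        constructor
        · rintro ⟨β, hβ, e⟩
          obtain ⟨c, hcS, hcb, rfl⟩ := hpred b.1 (hrS _ _ hb).1 β hβ
          refine ⟨S.ofMem hcS, ⟨hcb, ?_⟩, (hf' _ _).2 ⟨htrans _ _ _ hcb hb, e.symm⟩⟩
          rintro rfl
          exact lt_irrefl _ hβ
        · rintro ⟨c, ⟨hcb, hne⟩, hcw⟩
          exact ⟨ht c.1, hht2 _ _ hcb (fun e => hne (Subtype.ext e)), ((hf' _ _).1 hcw).2.symm⟩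
    obtain ⟨o, hoM, f, hyo, htot, hrec⟩ := FODef.witness M hQ ![y, r]
      (by intro i; fin_cases i <;> assumption) hex
    change zle f.1 y.1 o.1 at hyo
    change ∀ b : HSet θ, zle r.1 b.1 y.1 → _ at htot
    change ∀ b u : HSet θ, zle r.1 b.1 y.1 → zle f.1 b.1 u.1 →
        ∀ w : HSet θ, w.1 ∈ u.1 ↔
          ∃ c : HSet θ, (zle r.1 c.1 b.1 ∧ ¬ c = b) ∧ zle f.1 c.1 w.1 at hrec
    have hmain : ∀ β : Ordinal, ∀ b u : HSet θ, ht b.1 = β → zle r.1 b.1 y.1 →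
        zle f.1 b.1 u.1 → u.1 = (ht b.1).toZFSet := by
      intro β
      induction β using WellFoundedLT.induction with
      | ind β ih =>
        rintro b u rfl hb hbu
        ext w
        rw [Ordinal.mem_toZFSet_iff]
        constructor
        · intro hw
          obtain ⟨c, ⟨hcb, hne⟩, hcw⟩ := (hrec b u hb hbu (u.ofMem hw)).1 hw
          have hlt := hht2 _ _ hcb (fun e => hne (Subtype.ext e))
          exact ⟨ht c.1, hlt, (ih _ hlt c _ rfl (htrans _ _ _ hcb hb) hcw).symm⟩
        · rintro ⟨β, hβ, rfl⟩
          obtain ⟨c, hcS, hcb, rfl⟩ := hpred b.1 (hrS _ _ hb).1 β hβ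
          obtain ⟨w, hw⟩ := htot (S.ofMem hcS) (htrans _ _ _ hcb hb)
          have e := ih _ hβ (S.ofMem hcS) w rfl (htrans _ _ _ hcb hb) hw
          change w.1 = (ht c).toZFSet at e
          rw [← e]
          refine (hrec b u hb hbu w).2 ⟨S.ofMem hcS, ⟨hcb, ?_⟩, hw⟩
          rintro rfl
          exact lt_irrefl _ hβ
    have ho := hmain _ y o rfl (hrefl _ hyS) hyo
    refine (hδ _).2 ⟨hht1 _ hyS, o, hoM, ?_, ?_⟩
    · rw [ho]
      refine ⟨(ZFSet.isOrdinal_toZFSet _).isTransitive, fun a ha => ?_⟩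
      exact ((ZFSet.isOrdinal_toZFSet _).mem ha).isTransitive
    · rw [ho, Ordinal.rank_toZFSet]
  -- minimal elements of `X`
  have hmin : ∃ y : HSet θ, (y.1 ∈ X.1 ∧ ∀ b : HSet θ, b.1 ∈ X.1 → zle r.1 b.1 y.1 → b = y) ∧
      zle r.1 y.1 z := by
    obtain ⟨y, ⟨hyX, hyz⟩, hy⟩ := (InvImage.wf ht (wellFounded_lt (α := Ordinal))).has_min
      {y | y ∈ X.1 ∧ zle r.1 y z} ⟨z, hz, hrefl _ (hXS _ hz)⟩
    refine ⟨X.ofMem hyX, ⟨hyX, fun b hb hby => ?_⟩, hyz⟩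
    by_contra hne
    exact hy b.1 ⟨hb, htrans _ _ _ hby hyz⟩ (hht2 _ _ hby (fun e => hne (Subtype.ext e)))
  -- all minimal elements of `X` are in `M`
  have hminM : ∀ a : HSet θ, (a.1 ∈ X.1 ∧ ∀ b : HSet θ, b.1 ∈ X.1 → zle r.1 b.1 a.1 → b = a) →
      a ∈ M := by
    let Q2 : (Fin 2 ⊕ Unit → HSet θ) → HSet θ → Prop := fun v a0 =>
      a0.1 ∈ (v (.inl 0)).1 ∧
      (∀ a b : HSet θ, zle (v (.inr ())).1 a.1 b.1 → b.1 ∈ (v (.inl 0)).1) ∧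
      (∀ a b c : HSet θ, zle (v (.inr ())).1 a.1 b.1 → zle (v (.inr ())).1 a.1 c.1 → b = c) ∧
      ∀ B : HSet θ, a0.1 ∈ B.1 →
        (∀ a b : HSet θ, a.1 ∈ B.1 → zle (v (.inr ())).1 a.1 b.1 → b.1 ∈ B.1) →
        ∀ a : HSet θ, (a.1 ∈ (v (.inl 0)).1 ∧
          ∀ b : HSet θ, b.1 ∈ (v (.inl 0)).1 → zle (v (.inl 1)).1 b.1 a.1 → b = a) → a.1 ∈ B.1
    have hQ2 : FODef (fun w : (Fin 2 ⊕ Unit) ⊕ Unit → HSet θ =>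
        Q2 (fun i => w (Sum.inl i)) (w (Sum.inr ()))) := by
      refine .and (.mem _ _) (.and (.all (.all (.imp (.zle _ _ _) (.mem _ _)))) (.and
        (.all (.all (.all (.imp (.zle _ _ _) (.imp (.zle _ _ _) (.eq _ _))))))
        (.all (.imp (.mem _ _) (.imp (.all (.all (.imp (.mem _ _) (.imp (.zle _ _ _) (.mem _ _)))))
          (.all (.imp (.and (.mem _ _) (.all (.imp (.mem _ _) (.imp (.zle _ _ _) (.eq _ _)))))
            (.mem _ _))))))))
    let Q1 : (Fin 2 → HSet θ) → HSet θ → Prop := fun v g =>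
      ∃ a0, Q2 (Sum.elim v (fun _ => g)) a0
    have hQ1 : FODef (fun w : Fin 2 ⊕ Unit → HSet θ =>
        Q1 (fun i => w (Sum.inl i)) (w (Sum.inr ()))) := by
      refine FODef.congr (FODef.ex hQ2) fun w => ?_
      exact Iff.rfl
    have hex : ∃ g, Q1 ![X, r] g := by
      let A : Set ZFSet := {a | a ∈ X.1 ∧ ∀ b, b ∈ X.1 → zle r.1 b a → b = a}
      have hA : A.Countable := by
        apply hanti A (fun a ha => hXS _ ha.1)
        intro a ha b hb hne
        exact ⟨fun h => hne (hb.2 _ ha.1 h), fun h => hne (ha.2 _ hb.1 h).symm⟩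
      have hAof : ∀ a : HSet θ, (a.1 ∈ X.1 ∧
          ∀ b : HSet θ, b.1 ∈ X.1 → zle r.1 b.1 a.1 → b = a) → a.1 ∈ A :=
        fun a ha => ⟨ha.1, fun b hb h => congrArg Subtype.val (ha.2 (X.ofMem hb) hb h)⟩
      obtain ⟨y0, hy0, -⟩ := hmin
      have hAne : A.Nonempty := ⟨y0.1, hAof _ hy0⟩
      obtain ⟨e, he⟩ := Set.countable_iff_exists_injOn.1 hA
      obtain ⟨a0, ha0, ha0min⟩ := (InvImage.wf e (wellFounded_lt (α := ℕ))).has_min A hAne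
      obtain ⟨g, hg⟩ := HSet.exists_of_countable hθ
        ((fun p : ZFSet × ZFSet => ZFSet.pair p.1 p.2) '' {p ∈ A ×ˢ A | e p.1 < e p.2 ∧
          ∀ c ∈ A, e p.1 < e c → e p.2 ≤ e c})
        (((hA.prod hA).mono (Set.sep_subset _ _)).image _) (by
          rintro _ ⟨p, ⟨hp, -⟩, rfl⟩
          exact HSet.hered_pair hθ (X.2.mem hp.1.1) (X.2.mem hp.2.1))
      have hg' : ∀ a b, zle g.1 a b ↔ (a ∈ A ∧ b ∈ A) ∧ e a < e b ∧
          ∀ c ∈ A, e a < e c → e b ≤ e c := by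
        intro a b
        refine (hg _).trans ?_
        constructor
        · rintro ⟨⟨c, d⟩, h, eq⟩
          obtain ⟨rfl, rfl⟩ := ZFSet.pair_inj.1 eq
          exact h
        · intro h
          exact ⟨(a, b), h, rfl⟩
      refine ⟨g, X.ofMem ha0.1, ha0.1, ?_, ?_, ?_⟩
      · intro a b hab
        exact ((hg' _ _).1 hab).1.2.1
      · intro a b c hab hac
        obtain ⟨⟨h1, h2⟩, h3, h4⟩ := (hg' _ _).1 hab
        obtain ⟨⟨k1, k2⟩, k3, k4⟩ := (hg' _ _).1 hac
        exact Subtype.ext (he h2 k2 (le_antisymm (h4 _ k2 k3) (k4 _ h2 h3)))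
      · intro B hB0 hBg a ha
        change ∀ a b : HSet θ, a.1 ∈ B.1 → zle g.1 a.1 b.1 → b.1 ∈ B.1 at hBg
        have hind : ∀ n : ℕ, ∀ a ∈ A, e a = n → a ∈ B.1 := by
          intro n
          induction n using Nat.strong_induction_on with
          | _ n ih =>
            rintro a ha rfl
            by_cases hlt : ∃ c ∈ A, e c < e a
            · -- take the largest such value
              let F : Set ℕ := e '' {c ∈ A | e c < e a}
              have hF : F.Finite := (Set.finite_Iio (e a)).subset (by
                rintro _ ⟨c, hc, rfl⟩
                exact hc.2)
              obtain ⟨c, hcA, hca⟩ := hlt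
              obtain ⟨m, ⟨c, ⟨hcA, hca⟩, rfl⟩, hm⟩ := Set.exists_max_image F id hF
                ⟨e c, c, ⟨hcA, hca⟩, rfl⟩
              refine hBg (X.ofMem hcA.1) (X.ofMem ha.1) (ih _ hca c hcA rfl)
                ((hg' _ _).2 ⟨⟨hcA, ha⟩, hca, fun d hd hcd => ?_⟩)
              by_contra hlt
              exact absurd (hm (e d) ⟨d, ⟨hd, not_le.1 hlt⟩, rfl⟩) (not_le.2 hcd)
            · have h1 : ¬ e a < e a0 := ha0min a ha
              have h2 : ¬ e a0 < e a := fun h => hlt ⟨a0, ha0, h⟩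
              have : a = a0 := he ha ha0 (by omega)
              rw [this]
              exact hB0
        exact hind _ a.1 (hAof a ha) rfl
    obtain ⟨g, hgM, hg⟩ := FODef.witness M hQ1 ![X, r]
      (by intro i; fin_cases i <;> assumption) hex
    obtain ⟨a0, ha0M, h0, h1, h2, h3⟩ := FODef.witness M hQ2 (Sum.elim ![X, r] (fun _ => g))
      (by
        rintro (i | i)
        · fin_cases i <;> assumption
        · exact hgM) hg
    change ∀ a b : HSet θ, zle g.1 a.1 b.1 → b.1 ∈ X.1 at h1
    change ∀ a b c : HSet θ, zle g.1 a.1 b.1 → zle g.1 a.1 c.1 → b = c at h2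
    obtain ⟨B, hB⟩ := HSet.exists_of_countable hθ (Subtype.val '' (M : Set (HSet θ)))
      (hMctble.image _) (by
        rintro _ ⟨a, -, rfl⟩
        exact a.2)
    have hB' : ∀ a : HSet θ, a.1 ∈ B.1 ↔ a ∈ M := by
      intro a
      refine (hB _).trans ⟨?_, fun h => ⟨a, h, rfl⟩⟩
      rintro ⟨b, hb, e⟩
      exact Subtype.ext e ▸ hb
    intro a ha
    refine (hB' a).1 (h3 B ((hB' _).2 ha0M) ?_ a ha)
    intro c d hc hcd
    change zle g.1 c.1 d.1 at hcd
    obtain ⟨d', hd'M, hcd'⟩ := FODef.witness M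
      (Q := fun (v : Fin 2 → HSet θ) d => zle (v 0).1 (v 1).1 d.1) (.zle _ _ _) ![g, c]
      (by
        intro i
        fin_cases i
        · exact hgM
        · exact (hB' c).1 hc) ⟨d, hcd⟩
    rw [h2 c d d' hcd hcd']
    exact (hB' _).2 hd'M
  obtain ⟨y, hy, hyz⟩ := hmin
  have hlt : ht y.1 < ht x := hxht ▸ hM_ht y (hminM y hy) (hXS _ hy.1)
  have hne : y.1 ≠ x := fun e => by rw [e] at hlt; exact lt_irrefl _ hlt
  refine ⟨y.1, hy.1, ?_, hne⟩
  rcases hlin z y.1 x hyz hxz with h | h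
  · exact h
  · exact absurd (hht2 _ _ h hne.symm) (not_lt.2 hlt.le)
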